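/- MLR is not positively Medvedev reducible to Some(MLR, ω): there is no positive reduction Φ such that Φ^X ∈ MLR for every X ∈ Some(MLR, ω). -/

import Mathlib

open MeasureTheory

/-- Cantor space `2^ω`: functions from `ℕ` to `Bool`. -/
abbrev Cantor : Type := ℕ → Bool

/-- The fair-coin product measure on Cantor space (each bit is `true` with probability 1/2,
independently), realized concretely as the pushforward of Lebesgue measure on `[0,1)`
under the binary-digit map `x ↦ (n ↦ n-th binary digit of x)`. -/
noncomputable def fairCoin : Measure Cantor :=
  Measure.map (fun (x : ℝ) (n : ℕ) => decide ((⌊x * 2 ^ (n + 1)⌋ % 2 : ℤ) = 1))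
    (volume.restrict (Set.Ico (0 : ℝ) 1))

/-- The cylinder `[σ]` of all `X ∈ 2^ω` extending the finite binary string `σ`. -/
def cylinder (σ : List Bool) : Set Cantor :=
  {X | ∀ (i : ℕ) (h : i < σ.length), X i = σ.get ⟨i, h⟩}

/-- The `n`-th level `U_n` of a test `U`: the union of the cylinders enumerated by `U n`. -/
def testSet (U : ℕ → ℕ → Option (List Bool)) (n : ℕ) : Set Cantor :=
  ⋃ σ ∈ {σ : List Bool | ∃ k, U n k = some σ}, cylinder σ

/-- A Martin-Löf test: a computable enumeration of cylinders with `μ(U_n) ≤ 2^{-n}`. -/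
def MLTest (U : ℕ → ℕ → Option (List Bool)) : Prop :=
  Computable₂ U ∧ ∀ n, fairCoin (testSet U n) ≤ ((2 : ENNReal) ^ n)⁻¹

/-- The Martin-Löf random elements of Cantor space. -/
def MLR : Set Cantor :=
  {X | ∀ U : ℕ → ℕ → Option (List Bool), MLTest U → ∃ n, X ∉ testSet U n}

/-- The `i`-th column of `X`, via Mathlib's pairing bijection: `X_i(n) = X(⟨i,n⟩)`. -/
def col (X : Cantor) (i : ℕ) : Cantor := fun n => X (Nat.pair i n)

/-- `Some(C, ω)`: some column is in `C`. -/
def SomeOmega (C : Set Cantor) : Set Cantor := {X | ∃ i, col X i ∈ C}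

/-- `Many(C)`: infinitely many columns are in `C`. -/
def Many (C : Set Cantor) : Set Cantor := {X | {i | col X i ∈ C}.Infinite}

/-- The output `Φ^X` of the positive reduction given by the positive CNFs `c n`:
`Φ^X(n) = ⋀_{clause ∈ c n} ⋁_{i ∈ clause} X(i)`, with an empty conjunction true and an
empty disjunction false. -/
def posEval (c : ℕ → List (List ℕ)) (X : Cantor) : Cantor :=
  fun n => (c n).all fun clause => clause.any fun i => X i

/-- The binary digit map. -/
noncomputable def digitMap (x : ℝ) (n : ℕ) : Bool := decide ((⌊x * 2 ^ (n + 1)⌋ % 2 : ℤ) = 1)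

theorem fairCoin_eq : fairCoin = Measure.map digitMap (volume.restrict (Set.Ico (0 : ℝ) 1)) := rfl

theorem measurable_digitMap : Measurable digitMap := by
  refine measurable_pi_lambda _ fun n => ?_
  have h1 : Measurable fun x : ℝ => ⌊x * 2 ^ (n + 1)⌋ :=
    Int.measurable_floor.comp (measurable_id.mul_const _)
  exact (measurable_from_top (f := fun z : ℤ => decide ((z % 2 : ℤ) = 1))).comp h1

theorem digitMap_succ (x : ℝ) (n : ℕ) : digitMap x (n + 1) = digitMap (2 * x) n := by
  unfold digitMap
  have : x * 2 ^ (n + 1 + 1) = 2 * x * 2 ^ (n + 1) := by ring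
  rw [this]

theorem digitMap_sub_one (x : ℝ) (n : ℕ) : digitMap (x - 1) n = digitMap x n := by
  unfold digitMap
  have : (x - 1) * 2 ^ (n + 1) = x * 2 ^ (n + 1) - ((2 ^ (n + 1) : ℤ) : ℝ) := by
    push_cast; ring
  rw [this, Int.floor_sub_intCast]
  have h2 : (⌊x * 2 ^ (n + 1)⌋ - 2 ^ (n + 1) : ℤ) % 2 = ⌊x * 2 ^ (n + 1)⌋ % 2 := by
    rw [pow_succ]; omega
  rw [h2]

theorem digitMap_zero_lo {x : ℝ} (h0 : 0 ≤ x) (h1 : x < 1 / 2) : digitMap x 0 = false := by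
  have : ⌊x * 2 ^ (0 + 1)⌋ = 0 := by
    rw [Int.floor_eq_iff]; constructor <;> norm_num <;> linarith
  simp only [digitMap, this]; decide

theorem digitMap_zero_hi {x : ℝ} (h0 : 1 / 2 ≤ x) (h1 : x < 1) : digitMap x 0 = true := by
  have : ⌊x * 2 ^ (0 + 1)⌋ = 1 := by
    rw [Int.floor_eq_iff]; constructor <;> norm_num <;> linarith
  simp only [digitMap, this]; decide

/-- Reals in `[0,1)` whose first `N` digits at positions in `p` equal `b`. -/
def goodReals (p : ℕ → Bool) (b : Bool) (N : ℕ) : Set ℝ :=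
  {x | x ∈ Set.Ico (0 : ℝ) 1 ∧ ∀ i < N, p i = true → digitMap x i = b}

theorem vol_half (S : Set ℝ) (c : ℝ) :
    volume ((fun x : ℝ => 2 * x - c) ⁻¹' S) = 2⁻¹ * volume S := by
  have : (fun x : ℝ => 2 * x - c) ⁻¹' S
      = (fun x : ℝ => 2 * x) ⁻¹' ((fun x : ℝ => x + (-c)) ⁻¹' S) := by
    ext x; simp [sub_eq_add_neg]
  rw [this, Real.volume_preimage_mul_left (by norm_num : (2 : ℝ) ≠ 0),
    measure_preimage_add_right]
  congr 1
  rw [abs_of_pos (by norm_num), ENNReal.ofReal_inv_of_pos (by norm_num)]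
  norm_num

theorem volume_goodReals (b : Bool) (N : ℕ) : ∀ p : ℕ → Bool,
    volume (goodReals p b N) ≤ ((2 : ENNReal) ^ (Nat.count (fun i => p i = true) N))⁻¹ := by
  induction N with
  | zero =>
    intro p
    refine (measure_mono (t := Set.Ico (0 : ℝ) 1) fun x hx => hx.1).trans ?_
    simp
  | succ N ih =>
    intro p
    have hS := ih (fun i => p (i + 1))
    set S := goodReals (fun i => p (i + 1)) b N with hSdef
    have hlo : ∀ x ∈ goodReals p b (N + 1), x < 1 / 2 → x ∈ (fun x : ℝ => 2 * x - 0) ⁻¹' S := by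
      intro x hx h
      refine ⟨⟨by simpa using hx.1.1, by simp only [sub_zero]; linarith⟩, fun i hi hp => ?_⟩
      have := hx.2 (i + 1) (by omega) hp
      rw [digitMap_succ] at this
      simpa using this
    have hhi : ∀ x ∈ goodReals p b (N + 1), 1 / 2 ≤ x → x ∈ (fun x : ℝ => 2 * x - 1) ⁻¹' S := by
      intro x hx h
      refine ⟨⟨by linarith, by have := hx.1.2; linarith⟩, fun i hi hp => ?_⟩
      have := hx.2 (i + 1) (by omega) hp
      rw [digitMap_succ] at this
      rw [digitMap_sub_one]
      exact this
    rw [Nat.count_succ']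
    by_cases hp0 : p 0 = true
    · have key : volume (goodReals p b (N + 1)) ≤ 2⁻¹ * volume S := by
        cases b with
        | false =>
          rw [← vol_half S 0]
          refine measure_mono fun x hx => hlo x hx ?_
          by_contra hc
          have := digitMap_zero_hi (not_lt.1 hc) hx.1.2
          rw [hx.2 0 (by omega) hp0] at this
          cases this
        | true =>
          rw [← vol_half S 1]
          refine measure_mono fun x hx => hhi x hx ?_
          by_contra hc
          have := digitMap_zero_lo hx.1.1 (not_le.1 hc)
          rw [hx.2 0 (by omega) hp0] at this
          cases this
      refine key.trans ?_
      rw [if_pos hp0, pow_succ, mul_comm, ENNReal.mul_inv (by simp) (by simp)]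
      gcongr
    · rw [if_neg hp0, add_zero]
      refine le_trans ?_ hS
      calc volume (goodReals p b (N + 1))
          ≤ volume ((fun x : ℝ => 2 * x - 0) ⁻¹' S ∪ (fun x : ℝ => 2 * x - 1) ⁻¹' S) := by
            refine measure_mono fun x hx => ?_
            rcases lt_or_ge x (1 / 2) with h | h
            · exact Or.inl (hlo x hx h)
            · exact Or.inr (hhi x hx h)
        _ ≤ _ := measure_union_le _ _
        _ = volume S := by
            rw [vol_half, vol_half, ← add_mul, ENNReal.inv_two_add_inv_two, one_mul]

theorem fairCoin_good (p : ℕ → Bool) (b : Bool) (N : ℕ) :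
    fairCoin {X : Cantor | ∀ i < N, p i = true → X i = b}
      ≤ ((2 : ENNReal) ^ (Nat.count (fun i => p i = true) N))⁻¹ := by
  have hm : MeasurableSet {X : Cantor | ∀ i < N, p i = true → X i = b} := by
    simp only [Set.ofPred_forall]
    refine MeasurableSet.iInter fun i => MeasurableSet.iInter fun _ => MeasurableSet.iInter fun _ => ?_
    exact measurableSet_eq_fun (measurable_pi_apply i) measurable_const
  rw [fairCoin_eq, Measure.map_apply measurable_digitMap hm,
    Measure.restrict_apply (measurable_digitMap hm)]
  refine le_trans (measure_mono ?_) (volume_goodReals b N p)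
  intro x hx
  exact ⟨hx.2, hx.1⟩

theorem fairCoin_univ : fairCoin Set.univ = 1 := by
  rw [fairCoin_eq, Measure.map_apply measurable_digitMap MeasurableSet.univ]
  simp

theorem countable_computable₂ :
    {U : ℕ → ℕ → Option (List Bool) | Computable₂ U}.Countable := by
  have hc : (Set.range Nat.Partrec.Code.eval).Countable := Set.countable_range _
  let F : (ℕ → ℕ → Option (List Bool)) → (ℕ →. ℕ) := fun U n =>
    Part.some (Encodable.encode (U n.unpair.1 n.unpair.2))
  refine Set.countable_of_injective_of_countable_image (f := F) ?_ (hc.mono ?_)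
  · intro U _ V _ h
    funext a b
    have := congrFun h (Nat.pair a b)
    simpa [F] using this
  · rintro _ ⟨U, hU, rfl⟩
    refine Nat.Partrec.Code.exists_code.1 ?_
    have h1 : Computable fun n : ℕ => Encodable.encode (U n.unpair.1 n.unpair.2) :=
      Computable.encode.comp (Computable₂.comp hU (Computable.fst.comp Computable.unpair)
        (Computable.snd.comp Computable.unpair))
    exact Partrec.nat_iff.1 h1

theorem exists_mlr : ∃ X, X ∈ MLR := by
  by_contra hne
  push Not at hne
  have hcov : (Set.univ : Set Cantor) ⊆
      ⋃ U ∈ {U : ℕ → ℕ → Option (List Bool) | MLTest U}, ⋂ n, testSet U n := by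
    intro X _
    have := hne X
    simp only [MLR, Set.mem_ofPred_eq] at this
    push Not at this
    obtain ⟨U, hU, h⟩ := this
    exact Set.mem_biUnion hU (Set.mem_iInter.2 h)
  have hnull : fairCoin (⋃ U ∈ {U : ℕ → ℕ → Option (List Bool) | MLTest U}, ⋂ n, testSet U n) = 0 := by
    rw [measure_biUnion_null_iff (countable_computable₂.mono fun U hU => hU.1)]
    intro U hU
    refine le_antisymm (ge_of_tendsto' (x := Filter.atTop) (f := fun n : ℕ => ((2 : ENNReal)⁻¹) ^ n)
      ?_ fun n => ?_) bot_le
    · exact ENNReal.tendsto_pow_atTop_nhds_zero_of_lt_one (by simp)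
    · rw [← ENNReal.inv_pow]
      exact (measure_mono (Set.iInter_subset _ n)).trans (hU.2 n)
  have h1 := (measure_mono hcov).trans_eq hnull
  rw [fairCoin_univ] at h1
  simp at h1

/-- Boolean check that `σ` is `b` at positions `< m` in `p`. -/
def chk (p : ℕ → Bool) (b : Bool) (σ : List Bool) (m : ℕ) : Bool :=
  Nat.rec true (fun i acc => acc && (!(p i) || decide (σ[i]? = some b))) m

theorem chk_iff (p : ℕ → Bool) (b : Bool) (σ : List Bool) (m : ℕ) :
    chk p b σ m = true ↔ ∀ i < m, p i = true → σ[i]? = some b := by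
  induction m with
  | zero => simp [chk]
  | succ m ih =>
    have : chk p b σ (m + 1) = (chk p b σ m && (!(p m) || decide (σ[m]? = some b))) := rfl
    rw [this, Bool.and_eq_true, ih]
    constructor
    · rintro ⟨h1, h2⟩ i hi hp
      rcases Nat.lt_succ_iff_lt_or_eq.1 hi with h | rfl
      · exact h1 i h hp
      · simpa [hp] using h2
    · intro h
      refine ⟨fun i hi => h i (by omega), ?_⟩
      cases hp : p m
      · simp
      · simpa using h m (by omega) hp

theorem computable_chk {p : ℕ → Bool} (hp : Computable p) (b : Bool) :
    Computable fun σ : List Bool => chk p b σ σ.length := by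
  unfold chk
  refine Computable.nat_rec (h := fun (σ : List Bool) (q : ℕ × Bool) =>
    q.2 && (!(p q.1) || decide (σ[q.1]? = some b))) Computable.list_length
    (Computable.const true) ?_
  have hi : Computable fun q : List Bool × ℕ × Bool => q.2.1 :=
    Computable.fst.comp Computable.snd
  have hg : Computable fun q : List Bool × ℕ × Bool => decide (q.1[q.2.1]? = some b) := by
    have h1 : Computable fun q : List Bool × ℕ × Bool => q.1[q.2.1]? :=
      Computable.list_getElem?.comp Computable.fst hi
    have h2 : Primrec fun o : Option Bool => decide (o = some b) := Primrec.dom_finite _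
    exact h2.to_comp.comp h1
  have ha : Computable₂ (fun a b : Bool => a && b) := Primrec.and.to_comp
  have ho : Computable₂ (fun a b : Bool => a || b) := Primrec.or.to_comp
  have hn : Computable (fun a : Bool => !a) := Primrec.not.to_comp
  exact ha.comp (Computable.snd.comp Computable.snd) (ho.comp (hn.comp (hp.comp hi)) hg)

theorem computable_count {p : ℕ → Bool} (hp : Computable p) :
    Computable fun m : ℕ => Nat.count (fun i => p i = true) m := by
  have : Computable fun m : ℕ => (Nat.rec 0 (fun i acc => acc + (p i).toNat) m : ℕ) := by
    refine Computable.nat_rec (h := fun (_ : ℕ) (q : ℕ × ℕ) => q.2 + (p q.1).toNat) Computable.id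
      (Computable.const 0) ?_
    have ht : Computable Bool.toNat := (Primrec.dom_finite _).to_comp
    have hadd : Computable₂ (fun a b : ℕ => a + b) := Primrec.nat_add.to_comp
    exact hadd.comp (Computable.snd.comp Computable.snd)
      (ht.comp (hp.comp (Computable.fst.comp Computable.snd)))
  refine this.of_eq fun m => ?_
  induction m with
  | zero => simp
  | succ m ih =>
    rw [Nat.count_succ, ← ih]
    cases h : p m <;> simp [h]

/-- The test capturing reals constantly `b` on `p`. -/
def capTest (p : ℕ → Bool) (b : Bool) (n k : ℕ) : Option (List Bool) :=
  (Encodable.decode (α := List Bool) k).bind fun σ =>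
    bif (decide (n ≤ Nat.count (fun i => p i = true) σ.length) && chk p b σ σ.length)
      then some σ else none

theorem computable_capTest {p : ℕ → Bool} (hp : Computable p) (b : Bool) :
    Computable₂ (capTest p b) := by
  unfold capTest
  refine Computable.option_bind (Computable.decode.comp Computable.snd) ?_
  have ha : Computable₂ (fun a b : Bool => a && b) := Primrec.and.to_comp
  have hle : Computable₂ (fun a b : ℕ => decide (a ≤ b)) := Primrec.nat_le.decide.to_comp
  have hs : Computable fun q : (ℕ × ℕ) × List Bool => q.2 := Computable.snd
  exact Computable.cond
    (ha.comp (hle.comp (Computable.fst.comp Computable.fst)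
      ((computable_count hp).comp (Computable.list_length.comp hs)))
      ((computable_chk hp b).comp hs))
    (Computable.option_some.comp hs) (Computable.const none)

theorem capTest_eq_some {p : ℕ → Bool} {b : Bool} {n k : ℕ} {σ : List Bool}
    (h : capTest p b n k = some σ) :
    n ≤ Nat.count (fun i => p i = true) σ.length ∧ chk p b σ σ.length = true := by
  unfold capTest at h
  obtain ⟨τ, _, h⟩ := Option.bind_eq_some_iff.1 h
  cases hc : (decide (n ≤ Nat.count (fun i => p i = true) τ.length) && chk p b τ τ.length)
  · rw [hc] at h; simp at h
  · rw [hc] at h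
    simp only [cond_true, Option.some.injEq] at h
    subst h
    simpa using hc

theorem exists_count_ge {p : ℕ → Bool} (hinf : {i | p i = true}.Infinite) (n : ℕ) :
    ∃ N, n ≤ Nat.count (fun i => p i = true) N :=
  ⟨Nat.nth (fun i => p i = true) n, (Nat.count_nth_of_infinite hinf n).ge⟩

theorem not_mlr_of_const {p : ℕ → Bool} (hp : Computable p) (hinf : {i | p i = true}.Infinite)
    (b : Bool) {X : Cantor} (hX : ∀ i, p i = true → X i = b) : X ∉ MLR := by
  intro hR
  obtain ⟨n, hn⟩ := hR (capTest p b) ⟨computable_capTest hp b, fun n => by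
    have hex := exists_count_ge hinf n
    classical
    refine le_trans (measure_mono ?_) ((fairCoin_good p b (Nat.find hex)).trans ?_)
    · intro Y hY
      simp only [testSet, Set.mem_iUnion, Set.mem_ofPred_eq, exists_prop] at hY
      obtain ⟨σ, ⟨k, hk⟩, hY⟩ := hY
      obtain ⟨h1, h2⟩ := capTest_eq_some hk
      intro i hi hpi
      have hlen : i < σ.length := lt_of_lt_of_le hi (Nat.find_min' hex h1)
      have h3 := (chk_iff p b σ _).1 h2 i hlen hpi
      rw [hY i hlen]
      rw [List.getElem?_eq_getElem hlen] at h3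
      simpa using h3
    · exact ENNReal.inv_le_inv.2 (pow_le_pow_right₀ (by norm_num) (Nat.find_spec hex))⟩
  apply hn
  obtain ⟨N, hN⟩ := exists_count_ge hinf n
  simp only [testSet, Set.mem_iUnion, Set.mem_ofPred_eq, exists_prop]
  refine ⟨List.ofFn fun i : Fin N => X i, ⟨Encodable.encode (List.ofFn fun i : Fin N => X i), ?_⟩, ?_⟩
  · have hchk : chk p b (List.ofFn fun i : Fin N => X i) N = true := by
      rw [chk_iff]
      intro i hi hpi
      simp [hi, hX i hpi]
    simp [capTest, hN, hchk]
  · intro i hi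
    simp

/-- Does the CNF have a clause inside column 0? -/
def hasCol0 (L : List (List ℕ)) : Bool := decide (∃ C ∈ L, ∀ i ∈ C, i.unpair.1 = 0)

theorem computable_hasCol0 : Computable hasCol0 := by
  have h1 : PrimrecPred fun i : ℕ => i.unpair.1 = 0 :=
    Primrec.eq.comp (Primrec.fst.comp Primrec.unpair) (Primrec.const 0)
  have h2 : PrimrecPred fun L : List (List ℕ) => ∃ C ∈ L, ∀ i ∈ C, i.unpair.1 = 0 :=
    h1.forall_mem_list.exists_mem_list
  exact h2.decide.to_comp

/-- MLR is not positively Medvedev reducible to `Some(MLR, ω)`. -/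
theorem mlr_not_le_sp_someOmega_mlr :
    ¬ ∃ c : ℕ → List (List ℕ), Computable c ∧
      ∀ X ∈ SomeOmega MLR, posEval c X ∈ MLR := by
  rintro ⟨c, hc, hred⟩
  obtain ⟨R, hR⟩ := exists_mlr
  have hp : Computable fun n => hasCol0 (c n) := computable_hasCol0.comp hc
  by_cases hinf : {n | hasCol0 (c n) = true}.Infinite
  · -- zeros everywhere except `R` in column 1
    let X : Cantor := fun m => decide (m.unpair.1 = 1) && R m.unpair.2
    refine not_mlr_of_const hp hinf false (X := posEval c X) ?_ (hred X ⟨1, ?_⟩)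
    · intro n hn
      obtain ⟨C, hC, hC0⟩ := of_decide_eq_true hn
      rw [posEval, List.all_eq_false]
      refine ⟨C, hC, ?_⟩
      simp only [List.any_eq_true, not_exists, not_and]
      intro i hi
      simp [X, hC0 i hi]
    · have : col X 1 = R := by funext n; simp [col, X]
      rwa [this]
  · -- ones everywhere except `R` in column 0
    let X : Cantor := fun m => !decide (m.unpair.1 = 0) || R m.unpair.2
    have hp' : Computable fun n => !hasCol0 (c n) := Primrec.not.to_comp.comp hp
    have hinf' : {n | (!hasCol0 (c n)) = true}.Infinite := by
      have := (Set.not_infinite.1 hinf).infinite_compl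
      refine this.mono fun n hn => ?_
      simpa using hn
    refine not_mlr_of_const hp' hinf' true (X := posEval c X) ?_ (hred X ⟨0, ?_⟩)
    · intro n hn
      have hn' : ¬ ∃ C ∈ c n, ∀ i ∈ C, i.unpair.1 = 0 := by
        simpa only [hasCol0, Bool.not_eq_true', decide_eq_false_iff_not] using hn
      rw [posEval, List.all_eq_true]
      intro C hC
      by_contra hcon
      refine hn' ⟨C, hC, fun i hi => ?_⟩
      by_contra h0
      exact hcon (List.any_eq_true.2 ⟨i, hi, by simp [X, h0]⟩)
    · have : col X 0 = R := by funext n; simp [col, X]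
      rwa [this]
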